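/- arXiv:2303.11503 — 2 statements merged into one kernel-verified Lean document; each statement's English description precedes it below -/
import Mathlib

section
/- Let n, d, t, a, b, c be positive integers with 3 ≤ t ≤ d−2, d ≤ n−3, and a + b + c = n−d−1. Let H_{n,d,t;a,b,c} be the graph obtained from P_{d+1} ∪ ((K_a ∪ K_b) ∨ K_c) (where ∨ is the join and P_{d+1} = v₁…v_{d+1}) by joining every vertex of K_a to v_{t−2}, v_{t−1}, v_t, every vertex of K_b to v_t, v_{t+1}, v_{t+2}, and every vertex of K_c to v_{t−1}, v_t, v_{t+1}. Then μ_{n−d}(H_{n,d,t;a,b,c}) < n−d+2. -/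
open Matrix

/-- Sorted (nonincreasing) list of eigenvalues of a matrix, empty if not Hermitian. -/
noncomputable def heigList {𝕜 : Type} [RCLike 𝕜] {m : Type} [Fintype m] [DecidableEq m]
    (M : Matrix m m 𝕜) : List ℝ :=
  if h : M.IsHermitian then (Finset.univ.val.map h.eigenvalues).sort (· ≥ ·) else []

/-- `kthEig M k` is the k-th largest eigenvalue of `M` (1-indexed). -/
noncomputable def kthEig {𝕜 : Type} [RCLike 𝕜] {m : Type} [Fintype m] [DecidableEq m]
    (M : Matrix m m 𝕜) (k : ℕ) : ℝ :=
  (heigList M).getD (k - 1) 0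

/-- Laplacian matrix of a simple graph on a finite vertex type, over ℝ. -/
noncomputable def lapMat {V : Type} [Fintype V] [DecidableEq V] (G : SimpleGraph V) :
    Matrix V V ℝ :=
  letI := Classical.decRel G.Adj
  G.lapMatrix ℝ

/-- `lapμ G k` is the k-th largest Laplacian eigenvalue of `G` (1-indexed). -/
noncomputable def lapμ {V : Type} [Fintype V] [DecidableEq V] (G : SimpleGraph V) (k : ℕ) : ℝ :=
  kthEig (lapMat G) k

/-- Number of Laplacian eigenvalues of `G` in the closed interval `[a, b]`, with multiplicity. -/
noncomputable def mIcc {V : Type} [Fintype V] [DecidableEq V] (G : SimpleGraph V) (a b : ℝ) : ℕ :=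
  ((heigList (lapMat G)).filter (fun x => a ≤ x ∧ x ≤ b)).length

/-- The graph `H_{n,d,t;a,b,c}`: a path `v₁ … v_{d+1}` (vertices `0, …, d`), a clique `K_a`
(vertices `d+1, …, d+a`) joined to `v_{t-2}, v_{t-1}, v_t` (vertices `t-3, t-2, t-1`),
a clique `K_b` (vertices `d+a+1, …, d+a+b`) joined to `v_t, v_{t+1}, v_{t+2}`
(vertices `t-1, t, t+1`), and a clique `K_c` (vertices `d+a+b+1, …, n-1`) joined to every vertex
of `K_a ∪ K_b` and to `v_{t-1}, v_t, v_{t+1}` (vertices `t-2, t-1, t`). -/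
def Habc (n d t a b : ℕ) : SimpleGraph (Fin n) :=
  SimpleGraph.fromRel (fun i j =>
    (i.val + 1 = j.val ∧ j.val ≤ d) ∨
    (d + 1 ≤ i.val ∧ i.val ≤ d + a ∧ d + 1 ≤ j.val ∧ j.val ≤ d + a) ∨
    (d + a + 1 ≤ i.val ∧ i.val ≤ d + a + b ∧ d + a + 1 ≤ j.val ∧ j.val ≤ d + a + b) ∨
    (d + a + b + 1 ≤ i.val ∧ d + 1 ≤ j.val) ∨
    (d + 1 ≤ i.val ∧ i.val ≤ d + a ∧ (j.val = t - 3 ∨ j.val = t - 2 ∨ j.val = t - 1)) ∨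
    (d + a + 1 ≤ i.val ∧ i.val ≤ d + a + b ∧ (j.val = t - 1 ∨ j.val = t ∨ j.val = t + 1)) ∨
    (d + a + b + 1 ≤ i.val ∧ (j.val = t - 2 ∨ j.val = t - 1 ∨ j.val = t)))

theorem local_ineq (a b c xa xb xc u v u' v' Q P : ℝ) (ha : 1 ≤ a) (hb : 1 ≤ b) (hc : 1 ≤ c)
    (hxa : a * xa = u' + v' - u - v) (hxb : b * xb = u' + v' - u - v)
    (hQ : u^2+v^2+u'^2+v'^2 ≤ Q)
    (hP : P ≤ 4 * Q + ((u'-u)^2 - 2*u'^2-2*u^2) - u^2 - v^2 + ((v-v')^2-2*v^2-2*v'^2))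
    (hE : (a+b+c+3) * (Q + a*xa^2+b*xb^2+c*xc^2) ≤ P + c*a*(xc-xa)^2 + c*b*(xc-xb)^2
      + a*((xa-u')^2+(xa-u)^2+(xa-0)^2) + b*((xb-0)^2+(xb-v)^2+(xb-v')^2)
      + c*((xc-u)^2+(xc-0)^2+(xc-v)^2)) : Q = 0 ∧ xa = 0 ∧ xb = 0 ∧ xc = 0 := by
  have key : (a*xa+b*xb+c*xc+u+v)^2 + a*b*(xa-xb)^2 + 2*(u'+v'-u-v)^2
    + (b-1)*u^2+(a-1)*v^2+(u-v)^2+2*u*u'+2*v*v'+(b+c)*u'^2+(a+c)*v'^2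
    + (a+b+c-1)*(Q-(u^2+v^2+u'^2+v'^2)) ≤ 0 := by
    have e1 : 2*(a*xa)*(u'-v)+2*(b*xb)*(v'-u) = 2*(u'+v'-u-v)^2 := by rw [hxa, hxb]; ring
    rw [← e1]
    linarith [hE, hP]
  have h1 : 0 ≤ a*b*(xa-xb)^2 := by positivity
  have h2 : 0 ≤ (b-1)*u^2 := mul_nonneg (by linarith) (sq_nonneg _)
  have h3 : 0 ≤ (a-1)*v^2 := mul_nonneg (by linarith) (sq_nonneg _)
  have h4 : 0 ≤ (b+c-2)*u'^2 := mul_nonneg (by linarith) (sq_nonneg _)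
  have h5 : 0 ≤ (a+c-2)*v'^2 := mul_nonneg (by linarith) (sq_nonneg _)
  have h6 : 0 ≤ (a+b+c-3)*(Q-(u^2+v^2+u'^2+v'^2)) := mul_nonneg (by linarith) (by linarith)
  have key2 : (a*xa+b*xb+c*xc+u+v)^2 + 2*(u'+v'-u-v)^2
    + (u-v)^2+2*u*u'+2*v*v'+2*u'^2+2*v'^2 + 2*(Q-(u^2+v^2+u'^2+v'^2)) ≤ 0 := by
    linarith
  have key3 : (a*xa+b*xb+c*xc+u+v)^2 + (1/10)*(u^2+v^2+u'^2+v'^2) + 2*(Q-(u^2+v^2+u'^2+v'^2)) ≤ 0 := by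
    linarith [key2, sq_nonneg (u+v-u'-v'), sq_nonneg (u'+v'), sq_nonneg (u+v), sq_nonneg (u-v+u'-v'), sq_nonneg (u-v), sq_nonneg (u'-v')]
  have z0 := sq_nonneg u
  have z1 := sq_nonneg v
  have z2 := sq_nonneg u'
  have z3 := sq_nonneg v'
  have z4 := sq_nonneg (a*xa+b*xb+c*xc+u+v)
  have hu : u = 0 := by apply pow_eq_zero_iff (two_ne_zero) |>.1; linarith
  have hv : v = 0 := by apply pow_eq_zero_iff (two_ne_zero) |>.1; linarith
  have hu' : u' = 0 := by apply pow_eq_zero_iff (two_ne_zero) |>.1; linarith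
  have hv' : v' = 0 := by apply pow_eq_zero_iff (two_ne_zero) |>.1; linarith
  have hT : a*xa+b*xb+c*xc+u+v = 0 := by apply pow_eq_zero_iff (two_ne_zero) |>.1; linarith
  subst hu hv hu' hv'
  have a1 : xa = 0 := by
    have : a * xa = 0 := by linarith
    rcases mul_eq_zero.1 this with h | h
    · linarith
    · exact h
  have b1 : xb = 0 := by
    have : b * xb = 0 := by linarith
    rcases mul_eq_zero.1 this with h | h
    · linarith
    · exact h
  refine ⟨by linarith, a1, b1, ?_⟩
  rw [a1, b1] at hT
  have : c * xc = 0 := by linarith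
  rcases mul_eq_zero.1 this with h | h
  · linarith
  · exact h

theorem path_bound (f : ℕ → ℝ) (d m : ℕ) (hm : 2 ≤ m) (hmd : m + 2 ≤ d) (h0 : f m = 0) :
   (f (m-1))^2 + (f (m+1))^2 + (f (m-2))^2 + (f (m+2))^2 ≤ ∑ k ∈ Finset.range (d+1), f k ^2 ∧
   ∑ k ∈ Finset.range d, (f k - f (k+1))^2 ≤ 4 * (∑ k ∈ Finset.range (d+1), f k ^2) +
    ((f (m-2)-f (m-1))^2 - 2*(f (m-2))^2-2*(f (m-1))^2) - (f (m-1))^2 - (f (m+1))^2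
     + ((f (m+1)-f (m+2))^2-2*(f (m+1))^2-2*(f (m+2))^2) := by
  obtain ⟨m, rfl⟩ : ∃ k, m = k + 2 := ⟨m - 2, by omega⟩
  simp only [show m + 2 - 1 = m + 1 by omega, show m + 2 - 2 = m by omega]
  constructor
  · have hs : ({m+1, m+3, m, m+4} : Finset ℕ) ⊆ Finset.range (d+1) := by
      intro k; simp; omega
    have := Finset.sum_le_sum_of_subset_of_nonneg hs (f := fun k => f k ^2) (fun i _ _ => sq_nonneg _)
    rw [Finset.sum_insert (by simp), Finset.sum_insert (by simp), Finset.sum_insert (by simp), Finset.sum_singleton] at this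
    simpa [add_assoc] using this
  · have hs : ({m, m+1, m+2, m+3} : Finset ℕ) ⊆ Finset.range d := by
      intro k; simp; omega
    have := Finset.sum_le_sum_of_subset_of_nonneg hs (f := fun k => 2 * f k ^2 + 2 * f (k+1)^2 - (f k - f (k+1))^2)
      (fun i _ _ => by nlinarith [sq_nonneg (f i + f (i+1))])
    rw [Finset.sum_insert (by simp), Finset.sum_insert (by simp), Finset.sum_insert (by simp), Finset.sum_singleton] at this
    rw [Finset.sum_sub_distrib, Finset.sum_add_distrib, ← Finset.mul_sum, ← Finset.mul_sum] at this
    have e1 := Finset.sum_range_succ (fun k => f k ^2) d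
    have e2 := Finset.sum_range_succ' (fun k => f k ^2) d
    simp only [add_assoc, Nat.reduceAdd] at *
    rw [h0] at this
    nlinarith [sq_nonneg (f d), sq_nonneg (f 0)]

theorem card_small {n : ℕ} (M : Matrix (Fin n) (Fin n) ℝ) (h : M.IsHermitian) (k : ℕ) (θ : ℝ)
    (hk : k < n) (hθ : θ ≤ kthEig M (k+1)) :
    Fintype.card {i // h.eigenvalues i < θ} + (k + 1) ≤ n := by
  unfold kthEig heigList at hθ
  rw [dif_pos h] at hθ
  set s : Multiset ℝ := Finset.univ.val.map h.eigenvalues with hs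
  set l := s.sort (· ≥ ·) with hl
  have hlen : l.length = n := by simp [hl, hs]
  have hsort : l.Pairwise (· ≥ ·) := Multiset.pairwise_sort s (· ≥ ·)
  have hkl : k < l.length := by omega
  rw [Nat.add_sub_cancel, List.getD_eq_getElem _ _ hkl] at hθ
  have h1 : ∀ x ∈ l.take (k+1), decide (θ ≤ x) = true := by
    intro x hx
    obtain ⟨i, hi, rfl⟩ := List.mem_iff_getElem.1 hx
    rw [List.length_take] at hi
    rw [List.getElem_take]
    simp only [decide_eq_true_eq]
    rcases Nat.lt_or_ge i k with hik | hik
    · exact hθ.trans (List.pairwise_iff_getElem.1 hsort i k (by omega) hkl hik)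
    · have : i = k := by omega
      subst this; exact hθ
  have h2 : k + 1 ≤ l.countP (fun x => decide (θ ≤ x)) := by
    have := (List.take_sublist (k+1) l).countP_le (p := fun x => decide (θ ≤ x))
    rw [List.countP_eq_length.2 h1, List.length_take] at this
    omega
  have h3 : l.countP (fun x => decide (θ ≤ x)) = s.countP (fun x => θ ≤ x) := by
    rw [← Multiset.coe_countP, hl, Multiset.sort_eq]
  rw [h3, hs, Multiset.countP_map] at h2
  have h4 : Fintype.card {i // h.eigenvalues i < θ} = (Finset.univ.filter (fun i => h.eigenvalues i < θ)).card := by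
    rw [Fintype.card_subtype]
  have h5 := Finset.card_filter_add_card_filter_not (s := (Finset.univ : Finset (Fin n))) (fun i => h.eigenvalues i < θ)
  have h6 : Multiset.card (Multiset.filter (fun a => θ ≤ h.eigenvalues a) (Finset.univ : Finset (Fin n)).val) = (Finset.univ.filter (fun i => ¬ h.eigenvalues i < θ)).card := by
    simp only [not_lt]; rfl
  rw [Finset.card_univ, Fintype.card_fin] at h5
  omega

theorem quad_ge {n : ℕ} (M : Matrix (Fin n) (Fin n) ℝ) (h : M.IsHermitian) (θ : ℝ) (x : Fin n → ℝ)
    (hx : ∀ i, h.eigenvalues i < θ → (h.eigenvectorBasis i : Fin n → ℝ) ⬝ᵥ x = 0) :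
    θ * ∑ i, x i ^ 2 ≤ x ⬝ᵥ (M *ᵥ x) := by
  have key : ∀ y : Fin n → ℝ, x ⬝ᵥ y = ∑ i, ((h.eigenvectorBasis i : Fin n → ℝ) ⬝ᵥ x) * ((h.eigenvectorBasis i : Fin n → ℝ) ⬝ᵥ y) := by
    intro y
    have := h.eigenvectorBasis.sum_inner_mul_inner (WithLp.toLp 2 x) (WithLp.toLp 2 y)
    simp only [EuclideanSpace.inner_eq_star_dotProduct] at this
    simp only [star_trivial] at this
    rw [dotProduct_comm x y, ← this]
    refine Finset.sum_congr rfl fun i _ => ?_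
    rw [dotProduct_comm y]
  have e1 : ∀ i, (h.eigenvectorBasis i : Fin n → ℝ) ⬝ᵥ (M *ᵥ x) = h.eigenvalues i * ((h.eigenvectorBasis i : Fin n → ℝ) ⬝ᵥ x) := by
    intro i
    rw [dotProduct_mulVec, ← mulVec_transpose]
    have : Mᵀ = M := by rw [← conjTranspose_eq_transpose_of_trivial]; exact h
    rw [this, h.mulVec_eigenvectorBasis, smul_dotProduct, smul_eq_mul]
  have e2 : ∑ i, x i ^ 2 = x ⬝ᵥ x := by simp [dotProduct, sq]
  rw [e2, key x, key (M *ᵥ x), Finset.mul_sum]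
  refine Finset.sum_le_sum fun i _ => ?_
  rw [e1]
  by_cases hi : h.eigenvalues i < θ
  · rw [hx i hi]; simp
  · nlinarith [mul_self_nonneg ((h.eigenvectorBasis i : Fin n → ℝ) ⬝ᵥ x)]

theorem blk (n : ℕ) (f : ℕ → ℝ) (P Q : Finset ℕ) (α β : ℝ) (hP : P ⊆ Finset.range n)
    (hQ : Q ⊆ Finset.range n) (hα : ∀ i ∈ P, f i = α) (hβ : ∀ i ∈ Q, f i = β) :
    ∑ i ∈ Finset.range n, ∑ j ∈ Finset.range n,
      (if i ∈ P ∧ j ∈ Q then (f i - f j)^2 else 0) = P.card * (Q.card * (α - β)^2) := by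
  have h1 : ∀ i, ∑ j ∈ Finset.range n, (if i ∈ P ∧ j ∈ Q then (f i - f j)^2 else 0)
      = if i ∈ P then (Q.card * (α - β)^2) else 0 := by
    intro i
    by_cases hi : i ∈ P
    · simp only [hi, true_and, if_true]
      rw [← Finset.sum_filter, Finset.filter_mem_eq_inter, Finset.inter_eq_right.2 hQ,
        Finset.sum_congr rfl (fun j hj => by rw [hα i hi, hβ j hj]), Finset.sum_const, nsmul_eq_mul]
    · simp [hi]
  simp only [h1]
  rw [← Finset.sum_filter, Finset.filter_mem_eq_inter, Finset.inter_eq_right.2 hP,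
    Finset.sum_const, nsmul_eq_mul]

theorem pathSum (n d : ℕ) (hd : d < n) (f : ℕ → ℝ) :
    ∑ i ∈ Finset.range n, ∑ j ∈ Finset.range n,
      (if i + 1 = j ∧ j ≤ d then (f i - f j)^2 else 0) =
    ∑ k ∈ Finset.range d, (f k - f (k+1))^2 := by
  have h1 : ∀ i, ∑ j ∈ Finset.range n, (if i + 1 = j ∧ j ≤ d then (f i - f j)^2 else 0)
      = if i ∈ Finset.range d then (f i - f (i+1))^2 else 0 := by
    intro i
    simp only [ite_and]
    rw [Finset.sum_ite_eq]
    simp only [Finset.mem_range]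
    split_ifs <;> first | rfl | omega
  simp only [h1]
  rw [← Finset.sum_filter, Finset.filter_mem_eq_inter, Finset.inter_eq_right.2]
  intro k; simp; omega

theorem energy_le (n d t a b c : ℕ) (ht : 3 ≤ t) (ht' : t + 2 ≤ d)
    (habc : a + b + c + d + 1 = n) (f : ℕ → ℝ) (xa xb xc : ℝ)
    (hA : ∀ i, d + 1 ≤ i → i ≤ d + a → f i = xa)
    (hB : ∀ i, d + a + 1 ≤ i → i ≤ d + a + b → f i = xb)
    (hC : ∀ i, d + a + b + 1 ≤ i → i < n → f i = xc) :
    (fun i : Fin n => f i) ⬝ᵥ (lapMat (Habc n d t a b) *ᵥ (fun i : Fin n => f i)) ≤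
      ∑ k ∈ Finset.range d, (f k - f (k+1))^2 + c * a * (xc - xa)^2 + c * b * (xc - xb)^2
      + a * ((xa - f (t-3))^2 + (xa - f (t-2))^2 + (xa - f (t-1))^2)
      + b * ((xb - f (t-1))^2 + (xb - f t)^2 + (xb - f (t+1))^2)
      + c * ((xc - f (t-2))^2 + (xc - f (t-1))^2 + (xc - f t)^2) := by
  classical
  have e0 : (fun i : Fin n => f i) ⬝ᵥ (lapMat (Habc n d t a b) *ᵥ (fun i : Fin n => f i)) =
    (∑ i : Fin n, ∑ j : Fin n, if (Habc n d t a b).Adj i j then (f i - f j) ^ 2 else 0) / 2 := by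
    have := @SimpleGraph.lapMatrix_toLinearMap₂' (Fin n) ℝ _ (Habc n d t a b)
      (Classical.decRel _) _ _ _ (fun i : Fin n => f i)
    rw [toLinearMap₂'_apply'] at this
    unfold lapMat
    rw [this]
  rw [e0]
  set A := Finset.Ico (d+1) (d+a+1) with hAdef
  set B := Finset.Ico (d+a+1) (d+a+b+1) with hBdef
  set C := Finset.Ico (d+a+b+1) n with hCdef
  have hAn : A ⊆ Finset.range n := by intro k; simp [A]; omega
  have hBn : B ⊆ Finset.range n := by intro k; simp [B]; omega
  have hCn : C ⊆ Finset.range n := by intro k; simp [C]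
  have hAf : ∀ i ∈ A, f i = xa := by
    intro i hi; simp [A] at hi; exact hA i (by omega) (by omega)
  have hBf : ∀ i ∈ B, f i = xb := by
    intro i hi; simp [B] at hi; exact hB i (by omega) (by omega)
  have hCf : ∀ i ∈ C, f i = xc := by
    intro i hi; simp [C] at hi; exact hC i (by omega) (by omega)
  have cA : (A.card : ℝ) = a := by simp [A]
  have cB : (B.card : ℝ) = b := by simp [B]
  have cC : (C.card : ℝ) = c := by
    have : C.card = c := by simp [C]; omega
    rw [this]
  let T (P Q : Finset ℕ) (i j : ℕ) : ℝ := if i ∈ P ∧ j ∈ Q then (f i - f j)^2 else 0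
  have hT0 : ∀ P Q i j, 0 ≤ T P Q i j := by
    intro P Q i j; simp only [T]; split_ifs
    · positivity
    · exact le_rfl
  let Pa (i j : ℕ) : ℝ := if i + 1 = j ∧ j ≤ d then (f i - f j)^2 else 0
  have hPa0 : ∀ i j, 0 ≤ Pa i j := by
    intro i j; simp only [Pa]; split_ifs
    · positivity
    · exact le_rfl
  let G (i j : ℕ) : ℝ := Pa i j + T C A i j + T C B i j
    + (T A {t-3} i j + T A {t-2} i j + T A {t-1} i j)
    + (T B {t-1} i j + T B {t} i j + T B {t+1} i j)
    + (T C {t-2} i j + T C {t-1} i j + T C {t} i j)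
  have hG0 : ∀ i j, 0 ≤ G i j := by
    intro i j
    have := hPa0 i j
    simp only [G]
    repeat' first | exact hT0 _ _ _ _ | exact hPa0 _ _ | apply add_nonneg
  have hGP : ∀ i j, Pa i j ≤ G i j := by
    intro i j
    simp only [G]
    linarith [hT0 C A i j, hT0 C B i j, hT0 A {t-3} i j, hT0 A {t-2} i j, hT0 A {t-1} i j,
      hT0 B {t-1} i j, hT0 B {t} i j, hT0 B {t+1} i j, hT0 C {t-2} i j, hT0 C {t-1} i j,
      hT0 C {t} i j]
  have hGT : ∀ i j, T C A i j ≤ G i j ∧ T C B i j ≤ G i j ∧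
      (T A {t-3} i j ≤ G i j ∧ T A {t-2} i j ≤ G i j ∧ T A {t-1} i j ≤ G i j) ∧
      (T B {t-1} i j ≤ G i j ∧ T B {t} i j ≤ G i j ∧ T B {t+1} i j ≤ G i j) ∧
      (T C {t-2} i j ≤ G i j ∧ T C {t-1} i j ≤ G i j ∧ T C {t} i j ≤ G i j) := by
    intro i j
    simp only [G]
    have h0 := hPa0 i j
    have h1 := hT0 C A i j
    have h2 := hT0 C B i j
    have h3 := hT0 A {t-3} i j
    have h4 := hT0 A {t-2} i j
    have h5 := hT0 A {t-1} i j
    have h6 := hT0 B {t-1} i j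
    have h7 := hT0 B {t} i j
    have h8 := hT0 B {t+1} i j
    have h9 := hT0 C {t-2} i j
    have h10 := hT0 C {t-1} i j
    have h11 := hT0 C {t} i j
    refine ⟨?_, ?_, ⟨?_, ?_, ?_⟩, ⟨?_, ?_, ?_⟩, ⟨?_, ?_, ?_⟩⟩ <;> linarith
  have hTeq : ∀ P Q i j, i ∈ P → j ∈ Q → T P Q i j = (f i - f j)^2 := by
    intro P Q i j h1 h2; simp [T, h1, h2]
  -- one direction of the relation
  have hr : ∀ i j : ℕ, i < n → j < n → 
    ((i + 1 = j ∧ j ≤ d) ∨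
    (d + 1 ≤ i ∧ i ≤ d + a ∧ d + 1 ≤ j ∧ j ≤ d + a) ∨
    (d + a + 1 ≤ i ∧ i ≤ d + a + b ∧ d + a + 1 ≤ j ∧ j ≤ d + a + b) ∨
    (d + a + b + 1 ≤ i ∧ d + 1 ≤ j) ∨
    (d + 1 ≤ i ∧ i ≤ d + a ∧ (j = t - 3 ∨ j = t - 2 ∨ j = t - 1)) ∨
    (d + a + 1 ≤ i ∧ i ≤ d + a + b ∧ (j = t - 1 ∨ j = t ∨ j = t + 1)) ∨
    (d + a + b + 1 ≤ i ∧ (j = t - 2 ∨ j = t - 1 ∨ j = t))) → (f i - f j)^2 ≤ G i j := by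
    intro i j hi hj h
    obtain ⟨g1, g2, ⟨g3, g4, g5⟩, ⟨g6, g7, g8⟩, ⟨g9, g10, g11⟩⟩ := hGT i j
    have mA : d + 1 ≤ i → i ≤ d + a → i ∈ A := by intro h1 h2; simp [A]; omega
    have mB : d + a + 1 ≤ i → i ≤ d + a + b → i ∈ B := by intro h1 h2; simp [B]; omega
    have mC : d + a + b + 1 ≤ i → i ∈ C := by intro h1; simp [C]; omega
    rcases h with h | ⟨h1, h2, h3, h4⟩ | ⟨h1, h2, h3, h4⟩ | ⟨h1, h2⟩ | ⟨h1, h2, h3⟩ | ⟨h1, h2, h3⟩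
      | ⟨h1, h3⟩
    · have := hGP i j
      simpa only [Pa, if_pos h] using this
    · rw [hA i h1 h2, hA j h3 h4]; simpa using hG0 i j
    · rw [hB i h1 h2, hB j h3 h4]; simpa using hG0 i j
    · by_cases k1 : j ≤ d + a
      · rwa [hTeq C A i j (mC h1) (by simp [A]; omega)] at g1
      by_cases k2 : j ≤ d + a + b
      · rwa [hTeq C B i j (mC h1) (by simp [B]; omega)] at g2
      rw [hC i h1 hi, hC j (by omega) hj]; simpa using hG0 i j
    · have m := mA h1 h2
      rcases h3 with h3 | h3 | h3
      · rwa [hTeq _ _ i j m (by simp [h3])] at g3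
      · rwa [hTeq _ _ i j m (by simp [h3])] at g4
      · rwa [hTeq _ _ i j m (by simp [h3])] at g5
    · have m := mB h1 h2
      rcases h3 with h3 | h3 | h3
      · rwa [hTeq _ _ i j m (by simp [h3])] at g6
      · rwa [hTeq _ _ i j m (by simp [h3])] at g7
      · rwa [hTeq _ _ i j m (by simp [h3])] at g8
    · have m := mC h1
      rcases h3 with h3 | h3 | h3
      · rwa [hTeq _ _ i j m (by simp [h3])] at g9
      · rwa [hTeq _ _ i j m (by simp [h3])] at g10
      · rwa [hTeq _ _ i j m (by simp [h3])] at g11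
  have hadj : ∀ i j : Fin n, (if (Habc n d t a b).Adj i j then (f i - f j) ^ 2 else 0)
      ≤ G i j + G j i := by
    intro i j
    split_ifs with h
    · rw [Habc, SimpleGraph.fromRel_adj] at h
      rcases h.2 with h | h
      · have := hr i j i.2 j.2 h
        linarith [hG0 j i]
      · have := hr j i j.2 i.2 h
        have e : (f j - f i)^2 = (f i - f j)^2 := by ring
        linarith [hG0 i j]
    · exact add_nonneg (hG0 _ _) (hG0 _ _)
  have s1 : (∑ i : Fin n, ∑ j : Fin n, if (Habc n d t a b).Adj i j then (f i - f j) ^ 2 else 0)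
      ≤ ∑ i : Fin n, ∑ j : Fin n, (G i j + G j i) :=
    Finset.sum_le_sum fun i _ => Finset.sum_le_sum fun j _ => hadj i j
  have s2 : ∑ i : Fin n, ∑ j : Fin n, (G i j + G j i) =
      2 * ∑ i : Fin n, ∑ j : Fin n, G i j := by
    simp only [Finset.sum_add_distrib]
    rw [Finset.sum_comm (f := fun i j : Fin n => G j i)]
    ring
  have s3 : ∑ i : Fin n, ∑ j : Fin n, G i j =
      ∑ i ∈ Finset.range n, ∑ j ∈ Finset.range n, G i j := by
    rw [Finset.sum_range]
    refine Finset.sum_congr rfl fun i _ => ?_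
    rw [Finset.sum_range]
  have hsing : ∀ k, k < n → ({k} : Finset ℕ) ⊆ Finset.range n := by
    intro k hk; simpa using hk
  have hT : ∀ P Q α β, P ⊆ Finset.range n → Q ⊆ Finset.range n → (∀ i ∈ P, f i = α) →
    (∀ i ∈ Q, f i = β) → ∑ i ∈ Finset.range n, ∑ j ∈ Finset.range n, T P Q i j
      = P.card * (Q.card * (α - β)^2) := fun P Q α β h1 h2 h3 h4 => blk n f P Q α β h1 h2 h3 h4
  have hT1 : ∀ P α k, P ⊆ Finset.range n → k < n → (∀ i ∈ P, f i = α) →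
    ∑ i ∈ Finset.range n, ∑ j ∈ Finset.range n, T P {k} i j = P.card * (α - f k)^2 := by
    intro P α k h1 h2 h3
    rw [hT P {k} α (f k) h1 (hsing k h2) h3 (by simp)]
    simp
  have hPs : ∑ i ∈ Finset.range n, ∑ j ∈ Finset.range n, Pa i j
    = ∑ k ∈ Finset.range d, (f k - f (k+1))^2 := pathSum n d (by omega) f
  have s4 : ∑ i ∈ Finset.range n, ∑ j ∈ Finset.range n, G i j =
      ∑ k ∈ Finset.range d, (f k - f (k+1))^2 + c * a * (xc - xa)^2 + c * b * (xc - xb)^2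
      + a * ((xa - f (t-3))^2 + (xa - f (t-2))^2 + (xa - f (t-1))^2)
      + b * ((xb - f (t-1))^2 + (xb - f t)^2 + (xb - f (t+1))^2)
      + c * ((xc - f (t-2))^2 + (xc - f (t-1))^2 + (xc - f t)^2) := by
    simp only [G, Finset.sum_add_distrib]
    rw [hPs, hT C A xc xa hCn hAn hCf hAf, hT C B xc xb hCn hBn hCf hBf,
      hT1 A xa _ hAn (by omega) hAf, hT1 A xa _ hAn (by omega) hAf, hT1 A xa _ hAn (by omega) hAf,
      hT1 B xb _ hBn (by omega) hBf, hT1 B xb _ hBn (by omega) hBf, hT1 B xb _ hBn (by omega) hBf,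
      hT1 C xc _ hCn (by omega) hCf, hT1 C xc _ hCn (by omega) hCf, hT1 C xc _ hCn (by omega) hCf,
      cA, cB, cC]
    ring
  rw [s2, s3, s4] at s1
  linarith

theorem norm_eq (n d a b c : ℕ) (habc : a + b + c + d + 1 = n) (f : ℕ → ℝ) (xa xb xc : ℝ)
    (hA : ∀ i, d + 1 ≤ i → i ≤ d + a → f i = xa)
    (hB : ∀ i, d + a + 1 ≤ i → i ≤ d + a + b → f i = xb)
    (hC : ∀ i, d + a + b + 1 ≤ i → i < n → f i = xc) :
    ∑ i : Fin n, f i ^ 2 = ∑ k ∈ Finset.range (d+1), f k ^ 2 + a * xa^2 + b * xb^2 + c * xc^2 := by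
  rw [← Finset.sum_range (fun i => f i ^ 2), show n = d + 1 + a + b + c by omega,
    Finset.sum_range_add, Finset.sum_range_add, Finset.sum_range_add]
  have h1 : ∑ k ∈ Finset.range a, f (d + 1 + k)^2 = a * xa^2 := by
    refine (Finset.sum_congr rfl (g := fun _ => xa^2) (fun k hk => ?_)).trans (by simp)
    rw [Finset.mem_range] at hk; rw [hA (d + 1 + k) (by omega) (by omega)]
  have h2 : ∑ k ∈ Finset.range b, f (d + 1 + a + k)^2 = b * xb^2 := by
    refine (Finset.sum_congr rfl (g := fun _ => xb^2) (fun k hk => ?_)).trans (by simp)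
    rw [Finset.mem_range] at hk; rw [hB (d + 1 + a + k) (by omega) (by omega)]
  have h3 : ∑ k ∈ Finset.range c, f (d + 1 + a + b + k)^2 = c * xc^2 := by
    refine (Finset.sum_congr rfl (g := fun _ => xc^2) (fun k hk => ?_)).trans (by simp)
    rw [Finset.mem_range] at hk; rw [hC (d + 1 + a + b + k) (by omega) (by omega)]
  rw [h1, h2, h3]

theorem exists_vec (n d t a b c : ℕ) (ht : 3 ≤ t) (ht' : t + 2 ≤ d) (hc : 1 ≤ c)
    (habc : a + b + c + d + 1 = n) {ι : Type} [Fintype ι] (hι : Fintype.card ι ≤ d)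
    (w : ι → Fin n → ℝ) : ∃ x : Fin n → ℝ, x ≠ 0 ∧ (∀ i, w i ⬝ᵥ x = 0) ∧
      ∃ f : ℕ → ℝ, x = (fun i : Fin n => f i) ∧ f (t-1) = 0 ∧
      (∀ i, d + 1 ≤ i → i ≤ d + a → a * f i = f (t-3) + f (t+1) - f (t-2) - f t) ∧
      (∀ i, d + a + 1 ≤ i → i ≤ d + a + b → b * f i = f (t-3) + f (t+1) - f (t-2) - f t) ∧
      (∀ i, d + a + b + 1 ≤ i → i < n → f i = f (n-1)) := by
  let p (k : ℕ) : (Fin n → ℝ) →ₗ[ℝ] ℝ :=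
    if h : k < n then LinearMap.proj (⟨k, h⟩ : Fin n) else 0
  let S : (Fin n → ℝ) →ₗ[ℝ] ℝ := p (t-3) + p (t+1) - p (t-2) - p t
  let ψ : Fin (a + b + c) → (Fin n → ℝ) →ₗ[ℝ] ℝ := fun k =>
    if k.val < a then (a : ℝ) • p (d + 1 + k) - S
    else if k.val < a + b then (b : ℝ) • p (d + 1 + k) - S
    else if k.val + 1 < a + b + c then p (d + 1 + k) - p (n-1)
    else p (t-1)
  let Ψ : (Fin n → ℝ) →ₗ[ℝ] ((ι → ℝ) × (Fin (a + b + c) → ℝ)) :=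
    (LinearMap.pi (fun i => dotProductBilin ℝ ℝ (w i))).prod (LinearMap.pi ψ)
  have hker : LinearMap.ker Ψ ≠ ⊥ := by
    apply LinearMap.ker_ne_bot_of_finrank_lt
    rw [Module.finrank_prod, Module.finrank_fintype_fun_eq_card, Module.finrank_fintype_fun_eq_card,
      Module.finrank_fintype_fun_eq_card, Fintype.card_fin, Fintype.card_fin]
    omega
  obtain ⟨x, hx, hx0⟩ := Submodule.exists_mem_ne_zero_of_ne_bot hker
  rw [LinearMap.mem_ker] at hx
  have hw : ∀ i, w i ⬝ᵥ x = 0 := fun i => congrFun (congrArg Prod.fst hx) i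
  have hψ : ∀ k, ψ k x = 0 := fun k => congrFun (congrArg Prod.snd hx) k
  refine ⟨x, hx0, hw, fun k => p k x, ?_, ?_, ?_, ?_, ?_⟩
  · ext i; simp [p]
  · have := hψ ⟨a + b + c - 1, by omega⟩
    simp only [ψ] at this
    rw [if_neg (by omega), if_neg (by omega), if_neg (by omega)] at this
    exact this
  · intro i h1 h2
    have := hψ ⟨i - (d + 1), by omega⟩
    simp only [ψ] at this
    rw [if_pos (by omega), show d + 1 + (i - (d + 1)) = i by omega] at this
    simp only [S, LinearMap.sub_apply, LinearMap.add_apply, LinearMap.smul_apply, smul_eq_mul] at this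
    linarith
  · intro i h1 h2
    have := hψ ⟨i - (d + 1), by omega⟩
    simp only [ψ] at this
    rw [if_neg (by omega), if_pos (by omega), show d + 1 + (i - (d + 1)) = i by omega] at this
    simp only [S, LinearMap.sub_apply, LinearMap.add_apply, LinearMap.smul_apply, smul_eq_mul] at this
    linarith
  · intro i h1 h2
    by_cases hi : i = n - 1
    · rw [hi]
    have := hψ ⟨i - (d + 1), by omega⟩
    simp only [ψ] at this
    rw [if_neg (by omega), if_neg (by omega), if_pos (by omega),
      show d + 1 + (i - (d + 1)) = i by omega, LinearMap.sub_apply] at this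
    linarith

theorem Habc_eigenvalue_bound (n d t a b c : ℕ) (ht : 3 ≤ t) (ht' : t + 2 ≤ d)
    (hdn : d + 3 ≤ n) (ha : 1 ≤ a) (hb : 1 ≤ b) (hc : 1 ≤ c) (habc : a + b + c + d + 1 = n) :
    lapμ (Habc n d t a b) (n - d) < (n : ℝ) - d + 2 := by
  by_contra hcon
  push Not at hcon
  have hH : (lapMat (Habc n d t a b)).IsHermitian := by
    unfold lapMat
    exact @SimpleGraph.isHermitian_lapMatrix (Fin n) ℝ _ (Habc n d t a b) (Classical.decRel _) _ _ _
  have hθ : (n : ℝ) - d + 2 = a + b + c + 3 := by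
    rw [← habc]; push_cast; ring
  rw [hθ, lapμ, show n - d = (a + b + c) + 1 by omega] at hcon
  have hcard := card_small _ hH (a + b + c) _ (by omega) hcon
  obtain ⟨x, hx0, hw, f, hxf, f0, fA, fB, fC⟩ := exists_vec n d t a b c ht ht' hc habc
    (ι := {i // hH.eigenvalues i < (a : ℝ) + b + c + 3}) (by omega)
    (fun i => (hH.eigenvectorBasis i.1 : Fin n → ℝ))
  have hq := quad_ge _ hH ((a : ℝ) + b + c + 3) x (fun i hi => hw ⟨i, hi⟩)
  have ha' : (1 : ℝ) ≤ a := by exact_mod_cast ha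
  have hb' : (1 : ℝ) ≤ b := by exact_mod_cast hb
  have hc' : (1 : ℝ) ≤ c := by exact_mod_cast hc
  have hA : ∀ i, d + 1 ≤ i → i ≤ d + a → f i = f (d + 1) := by
    intro i h1 h2
    have e1 := fA i h1 h2
    have e2 := fA (d + 1) (by omega) (by omega)
    exact mul_left_cancel₀ (show (a : ℝ) ≠ 0 by linarith) (e1.trans e2.symm)
  have hB : ∀ i, d + a + 1 ≤ i → i ≤ d + a + b → f i = f (d + a + 1) := by
    intro i h1 h2
    have e1 := fB i h1 h2
    have e2 := fB (d + a + 1) (by omega) (by omega)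
    exact mul_left_cancel₀ (show (b : ℝ) ≠ 0 by linarith) (e1.trans e2.symm)
  have hE := energy_le n d t a b c ht ht' habc f _ _ _ hA hB fC
  have hN := norm_eq n d a b c habc f _ _ _ hA hB fC
  obtain ⟨hQ, hP⟩ := path_bound f d (t-1) (by omega) (by omega) f0
  rw [show t - 1 - 1 = t - 2 by omega, show t - 1 - 2 = t - 3 by omega,
    show t - 1 + 1 = t by omega, show t - 1 + 2 = t + 1 by omega] at hQ hP
  rw [hxf] at hq
  have hq2 := hq.trans hE
  rw [hN, f0] at hq2
  obtain ⟨z1, z2, z3, z4⟩ := local_ineq a b c (f (d+1)) (f (d+a+1)) (f (n-1)) (f (t-2)) (f t)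
    (f (t-3)) (f (t+1)) _ _ ha' hb' hc'
    (by have := fA (d + 1) (by omega) (by omega); linarith)
    (by have := fB (d + a + 1) (by omega) (by omega); linarith) hQ hP hq2
  apply hx0
  rw [z1, z2, z3, z4] at hN
  have hN' : ∑ i : Fin n, f i ^ 2 = 0 := by rw [hN]; simp
  rw [Finset.sum_eq_zero_iff_of_nonneg (fun i _ => sq_nonneg _)] at hN'
  rw [hxf]
  ext i
  exact pow_eq_zero_iff two_ne_zero |>.1 (hN' i (Finset.mem_univ i))
end

section
/- Let n, d, t be integers with 2 ≤ d ≤ n−3 and 2 ≤ t ≤ d, let G = G_{n,d,t} with diametral path P = v₁…v_{d+1}, and let w be any vertex of G outside P. Then for each i ∈ {t−1, t, t+1}, μ_{n−d}(G − v_i w) < n−d+2. -/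
open Matrix

/-- The graph `G_{n,d,t}`: a path `v₁ … v_{d+1}` (vertices `0, …, d`) together with a clique on
vertices `d+1, …, n-1`, each clique vertex joined to `v_{t-1}, v_t, v_{t+1}`
(vertices `t-2, t-1, t`). -/
def Gndt (n d t : ℕ) : SimpleGraph (Fin n) :=
  SimpleGraph.fromRel (fun i j =>
    (i.val + 1 = j.val ∧ j.val ≤ d) ∨
    (d + 1 ≤ i.val ∧ d + 1 ≤ j.val) ∨
    (d + 1 ≤ i.val ∧ (j.val = t - 2 ∨ j.val = t - 1 ∨ j.val = t)))


lemma kthEig_lt_aux {n : ℕ} (M : Matrix (Fin n) (Fin n) ℝ) (hM : M.IsHermitian) (r : ℝ)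
    (hr : 0 < r) (k : ℕ) (hk : 1 ≤ k) (hge : r ≤ kthEig M k) :
    k ≤ (Finset.univ.filter (fun i => r ≤ hM.eigenvalues i)).card := by
  unfold kthEig heigList at hge
  rw [dif_pos hM] at hge
  set l := (Finset.univ.val.map hM.eigenvalues).sort (· ≥ ·) with hl
  have hs : l.Pairwise (· ≥ ·) := Multiset.pairwise_sort _ _
  have hlen : k - 1 < l.length := by
    by_contra h
    rw [List.getD_eq_default _ _ (not_lt.mp h)] at hge
    linarith
  rw [List.getD_eq_getElem _ _ hlen] at hge
  have h1 : (l.take k).countP (fun y => decide (r ≤ y)) = k := by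
    have : (l.take k).length = k := by simp; omega
    rw [List.countP_eq_length.2, this]
    intro y hy
    obtain ⟨i, hi, rfl⟩ := List.mem_iff_getElem.1 hy
    rw [this] at hi
    simp only [List.getElem_take, decide_eq_true_eq]
    rcases Nat.lt_or_ge i (k-1) with h | h
    · exact hge.trans (List.pairwise_iff_getElem.1 hs _ _ _ _ h)
    · have : i = k - 1 := by omega
      subst this; exact hge
  have h2 : k ≤ l.countP (fun y => decide (r ≤ y)) :=
    h1.symm.le.trans ((List.take_sublist k l).countP_le)
  have h3 : (Multiset.countP (fun y => r ≤ y) (l : Multiset ℝ)) = l.countP (fun y => decide (r ≤ y)) :=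
    Multiset.coe_countP _ _
  rw [← h3, hl, Multiset.sort_eq, Multiset.countP_map] at h2
  exact h2

lemma kthEig_lt {n : ℕ} (M : Matrix (Fin n) (Fin n) ℝ) (hM : M.IsHermitian) (r : ℝ)
    (hr : 0 < r) (k : ℕ) {ι : Type} [Fintype ι] (φ : (Fin n → ℝ) →ₗ[ℝ] (ι → ℝ))
    (hk : Fintype.card ι < k)
    (H : ∀ x : Fin n → ℝ, x ≠ 0 → φ x = 0 → x ⬝ᵥ (M *ᵥ x) < r * (x ⬝ᵥ x)) :
    kthEig M k < r := by
  by_contra hcon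
  have hJ := kthEig_lt_aux M hM r hr k (by omega) (not_lt.mp hcon)
  set J := Finset.univ.filter (fun i => r ≤ hM.eigenvalues i) with hJdef
  let b : Fin n → Fin n → ℝ := fun i => (hM.eigenvectorBasis i).ofLp
  have hb : ∀ i j, b i ⬝ᵥ b j = if i = j then 1 else 0 := by
    intro i j
    have := (orthonormal_iff_ite.1 hM.eigenvectorBasis.orthonormal) i j
    rw [← this, EuclideanSpace.inner_eq_star_dotProduct, dotProduct_comm]
    simp [b]
  let ψ : (J → ℝ) →ₗ[ℝ] (Fin n → ℝ) := Fintype.linearCombination ℝ (fun j : J => b j)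
  have hψ : ∀ c, ψ c = ∑ j : J, c j • b j := fun c => rfl
  have hker : LinearMap.ker (φ ∘ₗ ψ) ≠ ⊥ := by
    apply LinearMap.ker_ne_bot_of_finrank_lt
    simp only [Module.finrank_fintype_fun_eq_card, Fintype.card_coe]
    omega
  obtain ⟨c, hc, hc0⟩ := Submodule.exists_mem_ne_zero_of_ne_bot hker
  have hMψ : M *ᵥ ψ c = ∑ j : J, (c j * hM.eigenvalues j) • b j := by
    rw [hψ, Matrix.mulVec_sum]
    refine Finset.sum_congr rfl fun j _ => ?_
    rw [Matrix.mulVec_smul, mul_smul]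
    congr 1
    exact hM.mulVec_eigenvectorBasis j
  have e : ∀ f g : J → ℝ, (∑ j : J, f j • b j) ⬝ᵥ (∑ j : J, g j • b j) = ∑ j : J, f j * g j := by
    intro f g
    simp only [sum_dotProduct, dotProduct_sum, smul_dotProduct, dotProduct_smul, hb,
      Subtype.coe_inj]
    simp only [smul_eq_mul, mul_ite, mul_one, mul_zero]
    simp [mul_comm]
  have e1 : ψ c ⬝ᵥ ψ c = ∑ j, c j * c j := by rw [hψ, e]
  have e2 : ψ c ⬝ᵥ (M *ᵥ ψ c) = ∑ j, c j * (c j * hM.eigenvalues j) := by rw [hMψ, hψ, e]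
  have hne : ψ c ≠ 0 := by
    intro h
    rw [h] at e1
    simp only [dotProduct_zero] at e1
    apply hc0
    funext j
    have := (Finset.sum_eq_zero_iff_of_nonneg (fun j _ => mul_self_nonneg (c j))).1 e1.symm j
      (Finset.mem_univ _)
    simpa using this
  have := H _ hne (by simpa using hc)
  rw [e1, e2, Finset.mul_sum] at this
  apply absurd this (not_lt.mpr _)
  refine Finset.sum_le_sum fun j _ => ?_
  have hj : r ≤ hM.eigenvalues j := (Finset.mem_filter.1 j.2).2
  nlinarith [mul_self_nonneg (c j)]

lemma clique_sum {V : Type} [DecidableEq V] (K : Finset V) (w : V) (hw : w ∈ K) (x : V → ℝ) (c : ℝ)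
    (hx : ∀ k ∈ K, k ≠ w → x k = c) (g : ℝ → ℝ) :
    ∑ k ∈ K, g (x k) = ((K.card : ℝ) - 1) * g c + g (x w) := by
  rw [← Finset.add_sum_erase K _ hw,
    Finset.sum_congr rfl (g := fun _ => g c) (fun k hk => by
      rw [hx k (Finset.mem_of_mem_erase hk) (Finset.ne_of_mem_erase hk)])]
  rw [Finset.sum_const, Finset.card_erase_of_mem hw, nsmul_eq_mul,
    Nat.cast_sub (Finset.card_pos.2 ⟨w, hw⟩)]
  push_cast; ring

lemma sum_unique_le {V : Type} [Fintype V] (p : V → Prop) [DecidablePred p] (y : ℝ) (hy : 0 ≤ y)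
    (hp : ∀ i j, p i → p j → i = j) : (∑ j, if p j then y else 0) ≤ y := by
  rw [← Finset.sum_filter, Finset.sum_const, nsmul_eq_mul]
  have : (Finset.univ.filter p).card ≤ 1 := by
    rw [Finset.card_le_one]
    intro i hi j hj
    exact hp i j (by simpa using hi) (by simpa using hj)
  have : ((Finset.univ.filter p).card : ℝ) ≤ 1 := by exact_mod_cast this
  nlinarith

lemma sum_pair {V : Type} [Fintype V] [DecidableEq V] (F : V → V → ℝ) (p q : V) :
    (∑ i, ∑ j, if i = p ∧ j = q then F i j else 0) = F p q := by
  rw [Finset.sum_eq_single p, Finset.sum_eq_single q] <;> simp +contextual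

lemma sum_left {V : Type} [Fintype V] [DecidableEq V] (F : V → V → ℝ) (K : Finset V) (q : V) :
    (∑ i, ∑ j, if i ∈ K ∧ j = q then F i j else 0) = ∑ i ∈ K, F i q := by
  simp [ite_and, Finset.sum_ite_mem]

lemma sum_both {V : Type} [Fintype V] [DecidableEq V] (F : V → V → ℝ) (K : Finset V) :
    (∑ i, ∑ j, if i ∈ K ∧ j ∈ K then F i j else 0) = ∑ i ∈ K, ∑ j ∈ K, F i j := by
  simp [ite_and, Finset.sum_ite_mem]

set_option maxHeartbeats 1600000 in
lemma quad_bound (n d t : ℕ) (hd : 2 ≤ d) (hdn : d + 3 ≤ n)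
    (ht : 2 ≤ t) (ht' : t ≤ d) (w v a f e : Fin n) (hw : d + 1 ≤ w.val)
    (ha : a.val = t - 2) (hf : f.val = t - 1) (he : e.val = t)
    (hv : v = a ∨ v = f ∨ v = e) (x : Fin n → ℝ) (s c : ℝ)
    (hae : x e = - x a) (hxw : x w = c + s) (hxf : x f = c - s)
    (hxk : ∀ k : Fin n, d + 1 ≤ k.val → k ≠ w → x k = c) (hx0 : x ≠ 0)
    (R : Fin n → Fin n → Prop) [DecidableRel R]
    (hR : ∀ i j, R i j ↔ ((Gndt n d t).deleteEdges {s(v, w)}).Adj i j) :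
    (∑ i, ∑ j, if R i j then (x i - x j) ^ 2 else 0) / 2 < ((n : ℝ) - d + 2) * ∑ i, x i ^ 2 := by
  classical
  set K : Finset (Fin n) := Finset.univ.filter (fun i => d + 1 ≤ i.val) with hK
  have mK : ∀ i, i ∈ K ↔ d + 1 ≤ i.val := by intro i; simp [hK]
  have cK : (K.card : ℝ) = (n : ℝ) - d - 1 := by
    have : K.card = n - (d + 1) := by
      have := Fin.card_filter_val_lt (n := n) (m := d+1)
      have h2 := Finset.card_filter_add_card_filter_not (s := (Finset.univ : Finset (Fin n))) (fun i => i.val < d + 1)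
      simp only [not_lt, Finset.card_univ, Fintype.card_fin] at h2
      rw [hK]; omega
    rw [this, Nat.cast_sub (by omega)]; push_cast; ring
  have haf : a ≠ f := by intro h; rw [Fin.ext_iff] at h; omega
  have hae' : a ≠ e := by intro h; rw [Fin.ext_iff] at h; omega
  have hfe : f ≠ e := by intro h; rw [Fin.ext_iff] at h; omega
  have haK : a ∉ K := by rw [mK]; omega
  have hfK : f ∉ K := by rw [mK]; omega
  have heK : e ∉ K := by rw [mK]; omega
  have hwK : w ∈ K := by rw [mK]; omega
  have hKs := clique_sum K w hwK x c (fun k hk => hxk k ((mK k).1 hk))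
  let tl : Fin n → ℝ := fun i => if i ∉ K ∧ i ≠ a ∧ i ≠ f ∧ i ≠ e then x i ^ 2 else 0
  have tl0 : ∀ i, 0 ≤ tl i := by intro i; simp only [tl]; split_ifs <;> positivity
  let A : Fin n → ℝ := fun i => 7/3 * tl i + 7/4 * (if i = e then x e ^ 2 else 0)
  let B : Fin n → ℝ := fun i => 7/3 * tl i + 7/4 * (if i = a then x a ^ 2 else 0)
  have A0 : ∀ i, 0 ≤ A i := by
    intro i; have := tl0 i; simp only [A]; split_ifs <;> positivity
  have B0 : ∀ i, 0 ≤ B i := by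
    intro i; have := tl0 i; simp only [B]; split_ifs <;> positivity
  set T := ∑ i, tl i with hT
  have sA : ∑ i, A i = 7/3 * T + 7/4 * x e ^ 2 := by
    simp only [A, Finset.sum_add_distrib, ← Finset.mul_sum, Finset.sum_ite_eq', Finset.mem_univ, if_true, hT]
  have sB : ∑ i, B i = 7/3 * T + 7/4 * x a ^ 2 := by
    simp only [B, Finset.sum_add_distrib, ← Finset.mul_sum, Finset.sum_ite_eq', Finset.mem_univ, if_true, hT]
  have sN : ∑ i, x i ^ 2 = T + x a ^ 2 + x f ^ 2 + x e ^ 2 + ((K.card - 1) * c ^ 2 + x w ^ 2) := by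
    have p : ∀ i, x i ^ 2 = tl i + (if i = a then x a ^ 2 else 0) + (if i = f then x f ^ 2 else 0)
        + (if i = e then x e ^ 2 else 0) + (if i ∈ K then x i ^ 2 else 0) := by
      intro i
      simp only [tl]
      by_cases h1 : i = a
      · subst h1; simp [haf, hae', haK]
      by_cases h2 : i = f
      · subst h2; simp [haf.symm, hfe, hfK]
      by_cases h3 : i = e
      · subst h3; simp [hae'.symm, hfe.symm, heK]
      by_cases h4 : i ∈ K <;> simp [h1, h2, h3, h4]
    rw [Finset.sum_congr rfl (fun i _ => p i)]
    simp only [Finset.sum_add_distrib, Finset.sum_ite_eq', Finset.mem_univ, if_true,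
      Finset.sum_ite_mem, Finset.univ_inter]
    rw [hKs (fun y => y ^ 2)]
  let D : Fin n → Fin n → ℝ := fun i j => (x i - x j) ^ 2
  have D0 : ∀ i j, 0 ≤ D i j := fun i j => sq_nonneg _
  have Ds : ∀ i j, D i j = D j i := by intro i j; simp only [D]; ring
  let P : Fin n → Fin n → ℝ := fun i j =>
    (if i.val + 1 = j.val ∧ j.val ≤ d then A i else 0) +
    (if i.val + 1 = j.val ∧ j.val ≤ d then B j else 0) +
    (if i = a ∧ j = f then D i j else 0) + (if i = f ∧ j = e then D i j else 0)
  let C : Fin n → Fin n → ℝ := fun i j => if i ∈ K ∧ j ∈ K then D i j else 0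
  let Q : Fin n → Fin n → ℝ := fun i j =>
    if i ∈ K ∧ (j = a ∨ j = f ∨ j = e) ∧ ¬ (i = w ∧ j = v) then D i j else 0
  have P0 : ∀ i j, 0 ≤ P i j := by
    intro i j
    have := A0 i; have := B0 j; have := D0 i j
    simp only [P]
    have h : ∀ (p : Prop) [Decidable p] (y : ℝ), 0 ≤ y → 0 ≤ (if p then y else 0) := by
      intro p _ y hy; split_ifs <;> simp [hy]
    have h1 := h (i.val + 1 = j.val ∧ j.val ≤ d) _ (A0 i)
    have h2 := h (i.val + 1 = j.val ∧ j.val ≤ d) _ (B0 j)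
    have h3 := h (i = a ∧ j = f) _ (D0 i j)
    have h4 := h (i = f ∧ j = e) _ (D0 i j)
    linarith
  have C0 : ∀ i j, 0 ≤ C i j := by
    intro i j; have := D0 i j; simp only [C]; split_ifs <;> simp [this]
  have Q0 : ∀ i j, 0 ≤ Q i j := by
    intro i j; have := D0 i j; simp only [Q]; split_ifs <;> simp [this]
  have hP : ∀ i j : Fin n, i.val + 1 = j.val → j.val ≤ d → D i j ≤ P i j := by
    intro i j h1 h2
    have hA := A0 i
    have hB := B0 j
    by_cases h3 : i = a
    · have h4 : j = f := by rw [Fin.ext_iff] at *; omega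
      subst h3 h4
      simp only [P, h1, h2, and_self, if_true, haf, false_and, if_false]
      linarith
    by_cases h4 : i = f
    · have h5 : j = e := by rw [Fin.ext_iff] at *; omega
      subst h4 h5
      simp only [P, h1, h2, and_self, if_true, haf.symm, false_and, if_false]
      linarith
    have g1 : j ≠ f := by intro h; apply h3; rw [Fin.ext_iff] at *; omega
    have g2 : j ≠ e := by intro h; apply h4; rw [Fin.ext_iff] at *; omega
    have g3 : j ∉ K := by rw [mK]; omega
    have g4 : i ∉ K := by rw [mK]; omega
    simp only [P, h1, h2, h3, h4, and_self, if_true, false_and, if_false, add_zero, A, B, tl, D]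
    by_cases h5 : i = e
    · have g5 : j ≠ a := by intro h; rw [Fin.ext_iff] at *; omega
      simp only [h5, g1, g2, g3, g5, ne_eq, not_true_eq_false, not_false_eq_true, and_self, and_false, if_true, if_false]
      nlinarith [sq_nonneg (3 * x e + 4 * x j)]
    · by_cases h6 : j = a
      · simp only [h3, h4, h5, h6, g4, ne_eq, not_true_eq_false, not_false_eq_true, and_self, and_false, false_and, if_true, if_false]
        nlinarith [sq_nonneg (3 * x a + 4 * x i)]
      · simp only [h3, h4, h5, h6, g1, g2, g3, g4, ne_eq, not_false_eq_true, and_self, if_true, if_false]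
        nlinarith [sq_nonneg (x i + x j), sq_nonneg (x i), sq_nonneg (x j)]
  -- pointwise domination
  have key : ∀ i j, (if R i j then (x i - x j) ^ 2 else 0) ≤
      (P i j + 1/2 * C i j + Q i j) + (P j i + 1/2 * C j i + Q j i) := by
    have half : ∀ i j, ((i.val + 1 = j.val ∧ j.val ≤ d) ∨
        (d + 1 ≤ i.val ∧ d + 1 ≤ j.val) ∨
        (d + 1 ≤ i.val ∧ (j.val = t - 2 ∨ j.val = t - 1 ∨ j.val = t))) →
        ¬ (i = w ∧ j = v) → D i j ≤
        (P i j + 1/2 * C i j + Q i j) + (P j i + 1/2 * C j i + Q j i) := by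
      intro i j h hn
      have := P0 i j; have := P0 j i; have := C0 i j; have := C0 j i
      have := Q0 i j; have := Q0 j i
      rcases h with ⟨h1, h2⟩ | ⟨h1, h2⟩ | ⟨h1, h2⟩
      · linarith [hP i j h1 h2]
      · have e1 : C i j = D i j := by
          simp only [C]; rw [if_pos ⟨(mK i).2 h1, (mK j).2 h2⟩]
        have e2 : C j i = D i j := by
          simp only [C]; rw [if_pos ⟨(mK j).2 h2, (mK i).2 h1⟩, Ds]
        linarith
      · have e1 : Q i j = D i j := by
          simp only [Q]
          refine if_pos ⟨(mK i).2 h1, ?_, hn⟩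
          simp only [Fin.ext_iff, ha, hf, he]; exact h2
        linarith
    intro i j
    split_ifs with hr
    · rw [hR, SimpleGraph.deleteEdges_adj] at hr
      obtain ⟨h1, h2⟩ := hr
      simp only [Gndt, SimpleGraph.fromRel_adj] at h1
      simp only [Set.mem_singleton_iff, Sym2.eq_iff, not_or] at h2
      rcases h1.2 with h | h
      · exact half i j h h2.2 
      · have := half j i h (fun h => h2.1 ⟨h.2, h.1⟩)
        rw [Ds] at this
        simp only [D] at this
        linarith
    · have := P0 i j; have := P0 j i; have := C0 i j; have := C0 j i
      have := Q0 i j; have := Q0 j i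
      linarith
  have tot : (∑ i, ∑ j, if R i j then (x i - x j) ^ 2 else 0) / 2 ≤
      ∑ i, ∑ j, P i j + 1/2 * ∑ i, ∑ j, C i j + ∑ i, ∑ j, Q i j := by
    have h1 := Finset.sum_le_sum (s := Finset.univ) fun i _ =>
      Finset.sum_le_sum (s := Finset.univ) fun j _ => key i j
    simp only [Finset.sum_add_distrib, ← Finset.mul_sum] at h1
    rw [Finset.sum_comm (f := fun i j => P j i), Finset.sum_comm (f := fun i j => C j i),
      Finset.sum_comm (f := fun i j => Q j i)] at h1
    linarith
  have sP : ∑ i, ∑ j, P i j ≤ 14/3 * T + 7/4 * x e ^ 2 + 7/4 * x a ^ 2 + D a f + D f e := by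
    simp only [P, Finset.sum_add_distrib]
    rw [sum_pair, sum_pair]
    have h1 : (∑ i : Fin n, ∑ j : Fin n, if i.val + 1 = j.val ∧ j.val ≤ d then A i else 0) ≤ ∑ i, A i :=
      Finset.sum_le_sum fun i _ => sum_unique_le _ _ (A0 i) (fun j k hj hk => Fin.ext (by omega))
    have h2 : (∑ i : Fin n, ∑ j : Fin n, if i.val + 1 = j.val ∧ j.val ≤ d then B j else 0) ≤ ∑ i, B i := by
      rw [Finset.sum_comm]
      exact Finset.sum_le_sum fun i _ => sum_unique_le _ _ (B0 i) (fun j k hj hk => Fin.ext (by omega))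
    linarith
  have sC : ∑ i, ∑ j, C i j = 2 * (K.card - 1) * s ^ 2 := by
    simp only [C]
    rw [sum_both]
    have h1 : ∀ i, ∑ j ∈ K, D i j = ((K.card : ℝ) - 1) * (x i - c) ^ 2 + (x i - x w) ^ 2 :=
      fun i => hKs (fun y => (x i - y) ^ 2)
    rw [Finset.sum_congr rfl (fun i _ => h1 i),
      hKs (fun y => ((K.card : ℝ) - 1) * (y - c) ^ 2 + (y - x w) ^ 2), hxw]
    ring
  have sQ : ∑ i, ∑ j, Q i j = ((K.card - 1) * (c - x a) ^ 2 + (x w - x a) ^ 2) +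
      ((K.card - 1) * (c - x f) ^ 2 + (x w - x f) ^ 2) +
      ((K.card - 1) * (c - x e) ^ 2 + (x w - x e) ^ 2) - (x w - x v) ^ 2 := by
    have p : ∀ i j, Q i j = (if i ∈ K ∧ j = a then D i j else 0) + (if i ∈ K ∧ j = f then D i j else 0)
        + (if i ∈ K ∧ j = e then D i j else 0) - (if i = w ∧ j = v then D i j else 0) := by
      intro i j
      simp only [Q]
      by_cases h0 : i ∈ K
      · by_cases h : i = w ∧ j = v
        · obtain ⟨rfl, rfl⟩ := h
          rcases hv with rfl | rfl | rfl
          · simp [h0, haf, hae']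
          · simp [h0, haf.symm, hfe]
          · simp [h0, hae'.symm, hfe.symm]
        · simp only [h, h0]
          by_cases h1 : j = a
          · subst h1; simp [haf, hae']
          by_cases h2 : j = f
          · subst h2; simp [haf.symm, hfe]
          by_cases h3 : j = e
          · subst h3; simp [hae'.symm, hfe.symm]
          · simp [h1, h2, h3]
      · have : i ≠ w := by rintro rfl; exact h0 hwK
        simp [h0, this]
    simp only [p, Finset.sum_add_distrib, Finset.sum_sub_distrib]
    rw [sum_pair, sum_left, sum_left, sum_left]
    have h1 : ∀ q, ∑ i ∈ K, D i q = ((K.card : ℝ) - 1) * (c - x q) ^ 2 + (x w - x q) ^ 2 :=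
      fun q => hKs (fun y => (y - x q) ^ 2)
    rw [h1, h1, h1]
  have hT0 : 0 ≤ T := Finset.sum_nonneg fun i _ => tl0 i
  have hm : (2:ℝ) ≤ K.card := by
    rw [cK]; have : ((d + 3 : ℕ) : ℝ) ≤ n := by exact_mod_cast hdn
    push_cast at this; linarith
  have hn : (n : ℝ) - d + 2 = K.card + 3 := by rw [cK]; ring
  rw [sC, sQ] at tot
  rw [sN, hn]
  simp only [D] at sP
  set m : ℝ := (K.card : ℝ) with hmdef
  rw [hae, hxf] at sP
  rw [hae, hxf, hxw] at tot
  rw [hae, hxf, hxw]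
  have fin : (m + 3) * (T + x a ^ 2 + (c - s) ^ 2 + (-x a) ^ 2 + ((m - 1) * c ^ 2 + (c + s) ^ 2)) -
     (∑ i, ∑ j, if R i j then (x i - x j) ^ 2 else 0) / 2 ≥
      (m + 3 - 14/3) * T + 1/2 * x a ^ 2 + (m+1)^2 * c ^ 2 + (c + s - x v) ^ 2 := by
    linear_combination tot + sP
  by_contra hcon
  have z1 : 0 ≤ (m + 3 - 14/3) * T := mul_nonneg (by linarith) hT0
  have z3 : 0 ≤ (m+1)^2 * c ^ 2 := by positivity
  have z2 := sq_nonneg (x a)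
  have z4 := sq_nonneg (c + s - x v)
  have y1 : (m + 3 - 14/3) * T = 0 := by linarith
  have y2 : x a ^ 2 = 0 := by linarith
  have y3 : (m+1)^2 * c ^ 2 = 0 := by linarith
  have y4 : (c + s - x v) ^ 2 = 0 := by linarith
  have T0 : T = 0 := by
    rcases mul_eq_zero.1 y1 with h | h
    · linarith
    · exact h
  have xa0 : x a = 0 := by simpa using y2
  have c0 : c = 0 := by
    rcases mul_eq_zero.1 y3 with h | h
    · have : m + 1 = 0 := by simpa using h
      linarith
    · simpa using h
  have s0 : s = 0 := by
    have y5 : c + s - x v = 0 := by simpa using y4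
    rcases hv with rfl | rfl | rfl
    · linarith
    · linarith
    · linarith
  apply hx0
  funext i
  have hti := (Finset.sum_eq_zero_iff_of_nonneg (fun j _ => tl0 j)).1 (hT.symm.trans T0) i
      (Finset.mem_univ _)
  simp only [tl] at hti
  simp only [Pi.zero_apply]
  by_cases h1 : i = a
  · rw [h1, xa0]
  by_cases h2 : i = f
  · rw [h2, hxf, c0, s0]; ring
  by_cases h3 : i = e
  · rw [h3, hae, xa0]; ring
  by_cases h4 : i ∈ K
  · by_cases h5 : i = w
    · rw [h5, hxw, c0, s0]; ring
    · rw [hxk i ((mK i).1 h4) h5, c0]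
  · rw [if_pos ⟨h4, h1, h2, h3⟩] at hti
    simpa using hti

lemma lapMat_herm {V : Type} [Fintype V] [DecidableEq V] (G : SimpleGraph V) :
    (lapMat G).IsHermitian := by
  letI := Classical.decRel G.Adj
  exact SimpleGraph.isHermitian_lapMatrix ℝ G

lemma lapMat_quad {V : Type} [Fintype V] [DecidableEq V] (G : SimpleGraph V) (x : V → ℝ) :
    letI := Classical.decRel G.Adj
    x ⬝ᵥ (lapMat G *ᵥ x) = (∑ i : V, ∑ j : V, if G.Adj i j then (x i - x j) ^ 2 else 0) / 2 := by
  letI := Classical.decRel G.Adj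
  have := SimpleGraph.lapMatrix_toLinearMap₂' ℝ G x
  rw [Matrix.toLinearMap₂'_apply'] at this
  exact this

theorem Gndt_delete_edge_eigenvalue_bound (n d t : ℕ) (hd : 2 ≤ d) (hdn : d + 3 ≤ n)
    (ht : 2 ≤ t) (ht' : t ≤ d) (w v : Fin n) (hw : d + 1 ≤ w.val)
    (hv : v.val = t - 2 ∨ v.val = t - 1 ∨ v.val = t) :
    lapμ ((Gndt n d t).deleteEdges {s(v, w)}) (n - d) < (n : ℝ) - d + 2 := by
  classical
  let a : Fin n := ⟨t - 2, by omega⟩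
  let f : Fin n := ⟨t - 1, by omega⟩
  let e : Fin n := ⟨t, by omega⟩
  have hv' : v = a ∨ v = f ∨ v = e := by simpa only [Fin.ext_iff] using hv
  have hdn' : ((d + 3 : ℕ) : ℝ) ≤ n := by exact_mod_cast hdn
  push_cast at hdn'
  let φ : (Fin n → ℝ) →ₗ[ℝ] ({i : Fin n // ¬ i.val < d + 1} → ℝ) :=
    { toFun := fun x k => if k.1 = w then x a + x e else 2 * x k - x w - x f
      map_add' := by
        intro x y; funext k
        simp only [Pi.add_apply]; split_ifs <;> ring
      map_smul' := by
        intro r x; funext k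
        simp only [Pi.smul_apply, smul_eq_mul, RingHom.id_apply]; split_ifs <;> ring }
  have hφ : ∀ x k, φ x k = if k.1 = w then x a + x e else 2 * x k - x w - x f := fun _ _ => rfl
  unfold lapμ
  refine kthEig_lt _ (lapMat_herm _) _ (by linarith) _ φ ?_ ?_
  · rw [Fintype.card_subtype_compl, Fintype.card_subtype, Fin.card_filter_val_lt, Fintype.card_fin]
    omega
  · intro x hx0 hx
    have h1 := congrFun hx ⟨w, by omega⟩
    rw [hφ, if_pos rfl] at h1
    simp only [Pi.zero_apply] at h1
    rw [lapMat_quad]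
    have h2 : x ⬝ᵥ x = ∑ i, x i ^ 2 := by
      simp only [dotProduct, sq]
    rw [h2]
    letI := Classical.decRel ((Gndt n d t).deleteEdges {s(v, w)}).Adj
    refine quad_bound n d t hd hdn ht ht' w v a f e hw rfl rfl rfl hv' x ((x w - x f) / 2)
      ((x w + x f) / 2) (by linarith) (by ring) (by ring) ?_ hx0 _ (fun i j => Iff.rfl)
    intro k hk hkw
    have h3 := congrFun hx ⟨k, by omega⟩
    rw [hφ, if_neg hkw] at h3
    simp only [Pi.zero_apply] at h3
    linarith
end
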